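/- Let M be a matroid on an n-element set E, and let Q'_M(x,y) = Σ_{a,b} q_{a,b} x^a y^b be the polynomial associated to a Q'-datum for M. Then the coefficients of Q'_M alternate in sign: for all a, b, the integer (−1)^{n−1−a−b}·q_{a,b} is nonnegative. Equivalently, every coefficient of the polynomial (−1)^{n−1}·Q'_M(−x,−y) is a nonnegative integer. -/

import Mathlib

open scoped Pointwise
open Finset

noncomputable section

/-- The standard simplex `Δ = conv{e_i : i ∈ E}` in `ℝ^E`. -/
def stdSimplexSet (α : Type*) [Fintype α] [DecidableEq α] : Set (α → ℝ) :=
  convexHull ℝ {x : α → ℝ | ∃ i : α, x = Pi.single i (1 : ℝ)}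

/-- The number of lattice points (points of `ℤ^E`) in a subset of `ℝ^E`. -/
def latticeCount {α : Type*} (P : Set (α → ℝ)) : ℕ :=
  Set.ncard {q : α → ℤ | (fun i => (q i : ℝ)) ∈ P}

/-- `Qcount P t u` is the number of lattice points of `P + uΔ + t∇`. -/
def Qcount {α : Type*} [Fintype α] [DecidableEq α] (P : Set (α → ℝ)) (t u : ℕ) : ℕ :=
  latticeCount (P + (u : ℝ) • stdSimplexSet α + (t : ℝ) • (-stdSimplexSet α))

/-- A polymatroid on a finite ground set, given by its rank function. -/
structure PolyMatroid (α : Type*) [Fintype α] [DecidableEq α] where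
  rk : Finset α → ℕ
  rk_empty : rk ∅ = 0
  rk_mono : ∀ ⦃S T : Finset α⦄, S ⊆ T → rk S ≤ rk T
  rk_submod : ∀ S T : Finset α, rk (S ∪ T) + rk (S ∩ T) ≤ rk S + rk T

variable {α : Type*} [Fintype α] [DecidableEq α]

/-- A basis of a matroid (an independent spanning set). -/
def PolyMatroid.IsBasis (M : PolyMatroid α) (B : Finset α) : Prop :=
  M.rk B = B.card ∧ M.rk B = M.rk Finset.univ

/-- The indicator vector of a finite set. -/
def indicatorVec {α : Type*} [DecidableEq α] (B : Finset α) : α → ℝ :=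
  fun i => if i ∈ B then 1 else 0

/-- The base polytope of a matroid: the convex hull of indicator vectors of bases. -/
def matroidPolytope (M : PolyMatroid α) : Set (α → ℝ) :=
  convexHull ℝ {x : α → ℝ | ∃ B : Finset α, M.IsBasis B ∧ x = indicatorVec B}

/-- The base polytope of a polymatroid, by its inequality description. -/
def PolyMatroid.polytope (M : PolyMatroid α) : Set (α → ℝ) :=
  {x | (∑ i, x i) = (M.rk Finset.univ : ℝ) ∧
    ∀ S : Finset α, (∑ i ∈ S, x i) ≤ (M.rk S : ℝ)}

/-- `c : ℕ × ℕ → ℤ` is a `Q'`-datum for the counting function `Q` if it is finitely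
supported and interpolates `Q` in the binomial basis. -/
def IsQdatumFun (Q : ℕ → ℕ → ℕ) (c : ℕ × ℕ → ℤ) : Prop :=
  (Function.support c).Finite ∧
    ∀ t u : ℕ, (Q t u : ℤ) = ∑ᶠ p : ℕ × ℕ, c p * (t.choose p.1 : ℤ) * (u.choose p.2 : ℤ)

/-- A `Q'`-datum for the lattice-point counting function of the polytope `P`. -/
def IsQdatum (P : Set (α → ℝ)) (c : ℕ × ℕ → ℤ) : Prop :=
  IsQdatumFun (Qcount P) c

/-- The polynomial `Q'` associated to a `Q'`-datum, as a function on `ℚ × ℚ`. -/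
def Qprime (c : ℕ × ℕ → ℤ) (x y : ℚ) : ℚ :=
  ∑ᶠ p : ℕ × ℕ, (c p : ℚ) * (x - 1) ^ p.1 * (y - 1) ^ p.2

/-- The polynomial `Q'` associated to a `Q'`-datum, as a polynomial in two variables. -/
def QprimePoly (c : ℕ × ℕ → ℤ) : MvPolynomial (Fin 2) ℤ :=
  ∑ᶠ p : ℕ × ℕ,
    MvPolynomial.C (c p) * (MvPolynomial.X 0 - 1) ^ p.1 * (MvPolynomial.X 1 - 1) ^ p.2

/-- The Tutte polynomial of a matroid, as a function on `ℚ × ℚ`. -/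
def TuttePoly (M : PolyMatroid α) (x y : ℚ) : ℚ :=
  ∑ S : Finset α,
    (x - 1) ^ (M.rk Finset.univ - M.rk S) * (y - 1) ^ (S.card - M.rk S)


namespace PolyMatroid

/-- Restriction form of submodularity: the marginal rank of `e` decreases along inclusions. -/
lemma rk_insert_add_le (M : PolyMatroid α) {S T : Finset α} (h : S ⊆ T) {e : α} (he : e ∉ T) :
    M.rk (insert e T) + M.rk S ≤ M.rk (insert e S) + M.rk T := by
  have h1 := M.rk_submod (insert e S) T
  rwa [insert_union, union_eq_right.2 h, insert_inter_of_notMem he, inter_eq_left.2 h] at h1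

lemma rk_insert_le (M : PolyMatroid α) (e : α) (S : Finset α) :
    M.rk (insert e S) ≤ M.rk {e} + M.rk S := by
  have h := M.rk_submod {e} S
  rw [← insert_eq] at h
  omega

/-- An independent set `I` extends to a maximal independent subset of `I ∪ D`. -/
lemma exists_independent_extension (M : PolyMatroid α) (hM : ∀ i, M.rk {i} ≤ 1)
    {I : Finset α} (hI : M.rk I = I.card) (D : Finset α) :
    ∃ J, I ⊆ J ∧ J ⊆ I ∪ D ∧ M.rk J = J.card ∧ M.rk J = M.rk (I ∪ D) := by
  induction D using Finset.induction_on with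
  | empty => exact ⟨I, by simp [hI]⟩
  | insert a D _ ih =>
    obtain ⟨J, hIJ, hJ, hind, hrk⟩ := ih
    have h1 : M.rk (insert a J) ≤ M.rk {a} + M.rk J := M.rk_insert_le a J
    have h2 : M.rk (insert a (I ∪ D)) ≤ M.rk {a} + M.rk (I ∪ D) := M.rk_insert_le a _
    have h3 := M.rk_mono (subset_insert a J)
    have h4 := M.rk_mono (insert_subset_insert a hJ)
    have h5 := M.rk_mono (subset_insert a (I ∪ D))
    have h6 := hM a
    rw [union_insert]
    by_cases h : M.rk (insert a J) = M.rk J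
    · refine ⟨J, hIJ, hJ.trans (subset_insert _ _), hind, ?_⟩
      have h7 := M.rk_submod (insert a J) (I ∪ D)
      have h8 := M.rk_mono (subset_inter (subset_insert a J) hJ)
      rw [insert_union, union_eq_right.2 hJ] at h7
      omega
    · have ha : a ∉ J := fun h' => h (by rw [insert_eq_of_mem h'])
      refine ⟨insert a J, hIJ.trans (subset_insert _ _), insert_subset_insert a hJ, ?_, ?_⟩
      · rw [card_insert_of_notMem ha]; omega
      · omega

/-- Some basis meets `A` in `rk A` elements. -/
lemma exists_isBasis_card_inter (M : PolyMatroid α) (hM : ∀ i, M.rk {i} ≤ 1) (A : Finset α) :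
    ∃ B, M.IsBasis B ∧ M.rk A ≤ (B ∩ A).card := by
  obtain ⟨I, -, hIA, hI, hrI⟩ :=
    M.exists_independent_extension hM (I := ∅) (by simp [M.rk_empty]) A
  obtain ⟨B, hIB, -, hB, hrB⟩ := M.exists_independent_extension hM hI univ
  refine ⟨B, ⟨hB, by rw [hrB, union_eq_right.2 (subset_univ _)]⟩, ?_⟩
  rw [empty_union] at hrI hIA
  rw [← hrI, hI]
  exact card_le_card (subset_inter hIB hIA)

lemma card_inter_le_rk (M : PolyMatroid α) (hM : ∀ i, M.rk {i} ≤ 1) {B : Finset α}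
    (hB : M.IsBasis B) (S : Finset α) : (B ∩ S).card ≤ M.rk S := by
  have h0 : ∀ D : Finset α, M.rk D ≤ D.card := by
    intro D
    induction D using Finset.induction_on with
    | empty => simp [M.rk_empty]
    | insert a D ha ih =>
      have := M.rk_insert_le a D
      have := hM a
      rw [card_insert_of_notMem ha]; omega
  have h1 := M.rk_submod (B ∩ S) (B \ S)
  have h2 : (B ∩ S) ∪ (B \ S) = B := by ext; simp; tauto
  have h3 := card_inter_add_card_sdiff B S
  have h4 := M.rk_mono (inter_subset_right : B ∩ S ⊆ S)
  have h5 := h0 (B \ S)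
  have h6 := hB.1
  rw [h2] at h1
  omega

/-- Contraction of an element, which becomes a loop of the result. -/
def contractElem (M : PolyMatroid α) (e : α) : PolyMatroid α where
  rk S := M.rk (insert e S) - M.rk {e}
  rk_empty := by simp
  rk_mono _ _ h := Nat.sub_le_sub_right (M.rk_mono (insert_subset_insert e h)) _
  rk_submod S T := by
    have h := M.rk_submod (insert e S) (insert e T)
    rw [← insert_inter_distrib, ← insert_union_distrib] at h
    have hU (U : Finset α) : M.rk {e} ≤ M.rk (insert e U) := M.rk_mono (by simp)
    have := hU S
    have := hU T
    have := hU (S ∩ T)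
    have := hU (S ∪ T)
    omega

lemma cast_contractElem_rk (M : PolyMatroid α) (e : α) (S : Finset α) :
    ((M.contractElem e).rk S : ℤ) = M.rk (insert e S) - M.rk {e} := by
  have : M.rk {e} ≤ M.rk (insert e S) := M.rk_mono (by simp)
  simp only [contractElem]
  omega

lemma contractElem_rk_singleton_le (M : PolyMatroid α) (hM : ∀ i, M.rk {i} ≤ 1) (e i : α) :
    (M.contractElem e).rk {i} ≤ 1 := by
  have h1 := M.rk_insert_le e {i}
  have h2 := hM i
  simp only [contractElem]
  omega

/-- The lattice points, supported on `E`, of the sum of the base polytope of the restriction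
`M|E` with `uΔ` and `t∇`, described by inequalities. -/
def LatticePoint (M : PolyMatroid α) (E : Finset α) (t u : ℕ) (q : α → ℤ) : Prop :=
  (∀ i ∉ E, q i = 0) ∧ ∑ i ∈ E, q i = M.rk E + u - t ∧
    ∀ S ⊆ E, S.Nonempty → ∑ i ∈ S, q i ≤ M.rk S + u

lemma finite_latticePoint (M : PolyMatroid α) (E : Finset α) (t u : ℕ) :
    {q | M.LatticePoint E t u q}.Finite := by
  refine (Set.finite_Icc (fun _ : α => -(t : ℤ)) (fun _ => (M.rk E + u : ℤ))).subset ?_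
  rintro q ⟨h0, hE, hS⟩
  have key : ∀ i, -(t : ℤ) ≤ q i ∧ q i ≤ M.rk E + u := by
    intro i
    by_cases hi : i ∈ E
    · have h1 := hS {i} (by simpa using hi) (by simp)
      have h2 : M.rk {i} ≤ M.rk E := M.rk_mono (by simpa using hi)
      have h3 := add_sum_erase E q hi
      have h4 : ∑ j ∈ E.erase i, q j ≤ M.rk E + u := by
        rcases (E.erase i).eq_empty_or_nonempty with h | h
        · rw [h, sum_empty]; positivity
        · have := hS _ (erase_subset i E) h
          have := M.rk_mono (erase_subset i E)
          omega
      rw [sum_singleton] at h1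
      omega
    · rw [h0 i hi]; omega
  exact ⟨fun i => (key i).1, fun i => (key i).2⟩

/-- The finite set of all lattice points in the sense of `LatticePoint`. -/
def latticePoints (M : PolyMatroid α) (E : Finset α) (t u : ℕ) : Finset (α → ℤ) :=
  (M.finite_latticePoint E t u).toFinset

lemma mem_latticePoints {M : PolyMatroid α} {E : Finset α} {t u : ℕ} {q : α → ℤ} :
    q ∈ M.latticePoints E t u ↔ M.LatticePoint E t u q := by
  simp [latticePoints]

lemma latticePoint_insert_iff {M : PolyMatroid α} {E : Finset α} {e : α} (he : e ∉ E)
    {t u : ℕ} {q : α → ℤ} :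
    M.LatticePoint (insert e E) t u q ↔
      (∀ i ∉ insert e E, q i = 0) ∧ q e + ∑ i ∈ E, q i = M.rk (insert e E) + u - t ∧
      (∀ S ⊆ E, S.Nonempty → ∑ i ∈ S, q i ≤ M.rk S + u) ∧
      ∀ S ⊆ E, q e + ∑ i ∈ S, q i ≤ M.rk (insert e S) + u := by
  unfold LatticePoint
  rw [sum_insert he]
  refine and_congr_right fun _ => and_congr_right fun _ => ⟨fun h => ⟨?_, ?_⟩, ?_⟩
  · exact fun S hS => h S (hS.trans (subset_insert _ _))
  · intro S hS
    rw [← sum_insert fun h' => he (hS h')]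
    exact h _ (insert_subset_insert e hS) (insert_nonempty _ _)
  · rintro ⟨h1, h2⟩ S hS hne
    by_cases heS : e ∈ S
    · have h3 := h2 (S.erase e) (by rwa [← subset_insert_iff])
      rwa [insert_erase heS, add_sum_erase _ _ heS] at h3
    · exact h1 S ((subset_insert_iff_of_notMem heS).1 hS) hne

lemma card_slice {M M' : PolyMatroid α} {E : Finset α} {e : α} (he : e ∉ E)
    {t u t' u' : ℕ} {v : ℤ}
    (h : ∀ q : α → ℤ, q e = v → (M.LatticePoint (insert e E) t u q ↔
      M'.LatticePoint E t' u' (Function.update q e 0))) :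
    #{q ∈ M.latticePoints (insert e E) t u | q e = v} = #(M'.latticePoints E t' u') := by
  refine card_nbij' (fun q => Function.update q e 0) (fun q => Function.update q e v) ?_ ?_ ?_ ?_
  · intro q hq
    simp only [coe_filter, mem_latticePoints, Set.mem_ofPred_eq] at hq
    simpa [mem_latticePoints] using (h q hq.2).1 hq.1
  · intro q hq
    rw [mem_coe, mem_latticePoints] at hq
    have h0 : q e = 0 := hq.1 e he
    have h1 : Function.update q e 0 = q := by rw [← h0]; simp
    simp only [coe_filter, mem_latticePoints, Set.mem_ofPred_eq]
    refine ⟨(h _ (by simp)).2 ?_, by simp⟩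
    simpa [h1] using hq
  · intro q hq
    simp only [coe_filter, Set.mem_ofPred_eq] at hq
    simp [← hq.2]
  · intro q hq
    rw [mem_coe, mem_latticePoints] at hq
    have h0 : q e = 0 := hq.1 e he
    simp [← h0]

lemma latticePoint_update_iff {M : PolyMatroid α} {E : Finset α} {e : α} (he : e ∉ E)
    {t u : ℕ} {q : α → ℤ} :
    M.LatticePoint E t u (Function.update q e 0) ↔
      (∀ i ∉ insert e E, q i = 0) ∧ ∑ i ∈ E, q i = M.rk E + u - t ∧
      ∀ S ⊆ E, S.Nonempty → ∑ i ∈ S, q i ≤ M.rk S + u := by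
  have hs : ∀ S ⊆ E, ∑ i ∈ S, Function.update q e 0 i = ∑ i ∈ S, q i := fun S hS =>
    sum_congr rfl fun i hi => Function.update_of_ne (ne_of_mem_of_not_mem (hS hi) he) _ _
  unfold LatticePoint
  rw [hs E subset_rfl]
  refine and_congr ⟨fun h i hi => ?_, fun h i hi => ?_⟩ (and_congr_right fun _ => ?_)
  · rw [mem_insert, not_or] at hi
    simpa [hi.1] using h i hi.2
  · by_cases hie : i = e
    · simp [hie]
    · simpa [hie] using h i (by simp [hie, hi])
  · exact forall₂_congr fun S hS => by rw [hs S hS]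

/-- Slices at small values of the coordinate `e` are lattice points for the deletion. -/
lemma card_lower_slice (M : PolyMatroid α) {E : Finset α} {e : α} (he : e ∉ E)
    {t u s : ℕ} (hs : s ≤ t) :
    #{q ∈ M.latticePoints (insert e E) t u |
      q e = M.rk (insert e E) - M.rk E - (t - s : ℤ)} = #(M.latticePoints E s u) := by
  refine card_slice he fun q hq => ?_
  rw [latticePoint_insert_iff he, latticePoint_update_iff he, hq]
  refine and_congr_right fun _ => ⟨fun h => ⟨by linarith [h.1], h.2.1⟩,
    fun h => ⟨by linarith [h.1], h.2, fun S hS => ?_⟩⟩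
  have h1 := M.rk_insert_add_le hS he
  rcases S.eq_empty_or_nonempty with rfl | hne
  · rw [M.rk_empty] at h1
    rw [sum_empty]
    omega
  · have := h.2 S hS hne
    omega

/-- Slices at large values of the coordinate `e` are lattice points for the contraction. -/
lemma card_upper_slice (M : PolyMatroid α) {E : Finset α} {e : α} (he : e ∉ E)
    {t u s : ℕ} (hs : s ≤ u) :
    #{q ∈ M.latticePoints (insert e E) t u | q e = M.rk {e} + (u - s : ℤ)} =
      #((M.contractElem e).latticePoints E t s) := by
  refine card_slice he fun q hq => ?_
  rw [latticePoint_insert_iff he, latticePoint_update_iff he, hq]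
  simp only [cast_contractElem_rk]
  refine and_congr_right fun _ => ⟨fun h => ⟨by linarith [h.1], fun S hS _ => by
    linarith [h.2.2 S hS]⟩, fun h => ⟨by linarith [h.1], fun S hS hne => ?_, fun S hS => ?_⟩⟩
  · have := h.2 S hS hne
    have := M.rk_insert_le e S
    omega
  · rcases S.eq_empty_or_nonempty with rfl | hne
    · simp
    · linarith [h.2 S hS hne]

lemma card_lower (M : PolyMatroid α) {E : Finset α} (hE : E.Nonempty) {e : α} (he : e ∉ E)
    (t u : ℕ) :
    #{q ∈ M.latticePoints (insert e E) t u | q e ≤ (M.rk (insert e E) - M.rk E : ℤ)} =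
      ∑ s ∈ range (t + 1), #(M.latticePoints E s u) := by
  have hmem : ∀ q ∈ M.latticePoints (insert e E) t u,
      (M.rk (insert e E) - M.rk E - t : ℤ) ≤ q e := by
    intro q hq
    rw [mem_latticePoints, latticePoint_insert_iff he] at hq
    have := hq.2.2.1 E subset_rfl hE
    linarith [hq.2.1]
  rw [card_eq_sum_card_fiberwise
    (f := fun q => (q e - (M.rk (insert e E) - M.rk E - t : ℤ)).toNat) (t := range (t + 1))]
  · refine sum_congr rfl fun s hs => ?_
    rw [mem_range] at hs
    rw [← M.card_lower_slice he (u := u) (show s ≤ t by omega), filter_filter]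
    refine congrArg card (filter_congr fun q hq => ?_)
    have := hmem q hq
    constructor
    · rintro ⟨h1, h2⟩; omega
    · intro h; constructor <;> omega
  · intro q hq
    simp only [coe_filter, Set.mem_ofPred_eq] at hq
    have := hmem q hq.1
    simp only [coe_range, Set.mem_Iio]
    omega

lemma card_upper (M : PolyMatroid α) {E : Finset α} {e : α} (he : e ∉ E)
    (t u : ℕ) :
    #{q ∈ M.latticePoints (insert e E) t u | (M.rk {e} : ℤ) ≤ q e} =
      ∑ s ∈ range (u + 1), #((M.contractElem e).latticePoints E t s) := by
  have hmem : ∀ q ∈ M.latticePoints (insert e E) t u, q e ≤ M.rk {e} + u := by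
    intro q hq
    rw [mem_latticePoints, latticePoint_insert_iff he] at hq
    simpa using hq.2.2.2 ∅ (empty_subset _)
  rw [card_eq_sum_card_fiberwise
    (f := fun q => (M.rk {e} + u - q e : ℤ).toNat) (t := range (u + 1))]
  · refine sum_congr rfl fun s hs => ?_
    rw [mem_range] at hs
    rw [← M.card_upper_slice he (t := t) (show s ≤ u by omega), filter_filter]
    refine congrArg card (filter_congr fun q hq => ?_)
    have := hmem q hq
    constructor
    · rintro ⟨h1, h2⟩; omega
    · intro h; constructor <;> omega
  · intro q hq
    simp only [coe_filter, Set.mem_ofPred_eq] at hq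
    have := hmem q hq.1
    simp only [coe_range, Set.mem_Iio]
    omega

/-- Deletion-contraction for lattice point counts; the last term on the left is present exactly
when `e` is a loop or a coloop. -/
lemma card_latticePoints_insert (M : PolyMatroid α) (hM : ∀ i, M.rk {i} ≤ 1) {E : Finset α}
    (hE : E.Nonempty) {e : α} (he : e ∉ E) (t u : ℕ) :
    #(M.latticePoints (insert e E) t u) +
      (if M.rk (insert e E) = M.rk E + M.rk {e} then #(M.latticePoints E t u) else 0) =
    ∑ s ∈ range (t + 1), #(M.latticePoints E s u) +
      ∑ s ∈ range (u + 1), #((M.contractElem e).latticePoints E t s) := by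
  have h1 := M.rk_insert_le e E
  have h2 := hM e
  have h3 := M.rk_mono (subset_insert e E)
  rw [← M.card_lower hE he, ← M.card_upper he, ← card_union_add_card_inter,
    ← filter_or, ← filter_and]
  congr 1
  · rw [filter_true_of_mem]
    intro q _
    omega
  · split_ifs with h
    · rw [← M.card_lower_slice he (le_refl t)]
      exact congrArg card (filter_congr fun q _ => by omega)
    · symm
      rw [card_eq_zero, filter_eq_empty_iff]
      intro q _
      omega

lemma card_latticePoints_singleton (M : PolyMatroid α) (e : α) (t u : ℕ) :
    #(M.latticePoints {e} t u) = 1 := by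
  rw [card_eq_one]
  refine ⟨Pi.single e (M.rk {e} + u - t : ℤ), ?_⟩
  ext q
  rw [mem_latticePoints, mem_singleton]
  constructor
  · rintro ⟨h0, h1, -⟩
    ext i
    by_cases hi : i = e
    · subst hi; simpa using h1
    · simpa [hi] using h0 i (by simpa using hi)
  · rintro rfl
    refine ⟨fun i hi => Pi.single_eq_of_ne (by simpa using hi) _, by simp, fun S hS hne => ?_⟩
    rw [hne.subset_singleton_iff.1 hS]
    simp

end PolyMatroid

section BinomialFunctional

open MvPolynomial

/-- The linear functional sending `x^a y^b` to `C(t+a,a) C(u+b,b)`, and hence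
`(x-1)^i (y-1)^j` to `C(t,i) C(u,j)`. -/
def binomEval (t u : ℕ) : MvPolynomial (Fin 2) ℤ →ₗ[ℤ] ℤ :=
  (basisMonomials (Fin 2) ℤ).constr ℤ
    fun d => ((t + d 0).choose (d 0) * (u + d 1).choose (d 1) : ℤ)

lemma binomEval_monomial (t u : ℕ) (d : Fin 2 →₀ ℕ) (a : ℤ) :
    binomEval t u (monomial d a) =
      a * ((t + d 0).choose (d 0) * (u + d 1).choose (d 1) : ℤ) := by
  have h : monomial d a = a • basisMonomials (Fin 2) ℤ d := by
    simp [coe_basisMonomials, smul_monomial]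
  rw [h, map_smul, binomEval, Module.Basis.constr_basis, smul_eq_mul]

lemma sum_range_choose_add (t a : ℕ) :
    ∑ s ∈ range (t + 1), (s + a).choose a = (t + (a + 1)).choose (a + 1) := by
  induction t with
  | zero => simp
  | succ t ih =>
    rw [sum_range_succ, ih, add_comm, show t + 1 + (a + 1) = (t + 1 + a) + 1 by ring,
      Nat.choose_succ_succ, show t + (a + 1) = t + 1 + a by ring]

lemma binomEval_X_zero_mul (t u : ℕ) (F : MvPolynomial (Fin 2) ℤ) :
    binomEval t u (X 0 * F) = ∑ s ∈ range (t + 1), binomEval s u F := by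
  induction F using MvPolynomial.induction_on' with
  | monomial d a =>
    rw [X, monomial_mul]
    simp only [binomEval_monomial, ← mul_sum, ← sum_mul]
    simp [← sum_range_choose_add, add_comm 1]
  | add p q hp hq => simp only [mul_add, map_add, hp, hq, sum_add_distrib]

lemma binomEval_X_one_mul (t u : ℕ) (F : MvPolynomial (Fin 2) ℤ) :
    binomEval t u (X 1 * F) = ∑ s ∈ range (u + 1), binomEval t s F := by
  induction F using MvPolynomial.induction_on' with
  | monomial d a =>
    rw [X, monomial_mul]
    simp only [binomEval_monomial, ← mul_sum]
    simp [← sum_range_choose_add, add_comm 1]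
  | add p q hp hq => simp only [mul_add, map_add, hp, hq, sum_add_distrib]

lemma sum_range_choose_eq (t i : ℕ) :
    ∑ s ∈ range t, (s.choose i : ℤ) = t.choose (i + 1) := by
  induction t with
  | zero => simp
  | succ t ih => rw [sum_range_succ, ih, Nat.choose_succ_succ]; push_cast; ring

lemma binomEval_X_one_sub_one_pow (t u j : ℕ) :
    binomEval t u ((X 1 - 1) ^ j) = u.choose j := by
  induction j generalizing u with
  | zero =>
    rw [pow_zero, ← C_1, C_apply, binomEval_monomial]
    simp
  | succ j ih =>
    rw [pow_succ', sub_mul, map_sub, binomEval_X_one_mul, one_mul, sum_range_succ,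
      add_sub_cancel_right]
    simp only [ih]
    exact sum_range_choose_eq u j

lemma binomEval_sub_one_pow_mul (t u i j : ℕ) :
    binomEval t u ((X 0 - 1) ^ i * (X 1 - 1) ^ j) = t.choose i * u.choose j := by
  induction i generalizing t with
  | zero => simp [binomEval_X_one_sub_one_pow]
  | succ i ih =>
    rw [pow_succ', mul_assoc, sub_mul, map_sub, binomEval_X_zero_mul, one_mul, sum_range_succ,
      add_sub_cancel_right]
    simp only [ih]
    rw [← sum_mul, sum_range_choose_eq]

lemma binomEval_aeval_sub_one (t u : ℕ) (H : MvPolynomial (Fin 2) ℤ) :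
    binomEval t u (aeval (fun i => (X i - 1 : MvPolynomial (Fin 2) ℤ)) H) =
      ∑ d ∈ H.support, H.coeff d * (t.choose (d 0) * u.choose (d 1) : ℤ) := by
  rw [aeval_eq_eval₂Hom, coe_eval₂Hom, eval₂_eq', map_sum]
  refine sum_congr rfl fun d _ => ?_
  rw [Fin.prod_univ_two, ← binomEval_sub_one_pow_mul, ← smul_eq_mul (a := coeff d H),
    ← map_smul, Algebra.smul_def]

lemma eq_zero_of_binomEval_eq_zero {G : MvPolynomial (Fin 2) ℤ}
    (h : ∀ t u, binomEval t u G = 0) : G = 0 := by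
  set H := aeval (fun i => (X i + 1 : MvPolynomial (Fin 2) ℤ)) G with hH
  have hG : aeval (fun i => (X i - 1 : MvPolynomial (Fin 2) ℤ)) H = G := by
    rw [hH, ← AlgHom.comp_apply, comp_aeval]
    simp
  suffices H0 : ∀ n, ∀ d : Fin 2 →₀ ℕ, d 0 + d 1 = n → H.coeff d = 0 by
    have : H = 0 := by ext d; simpa using H0 _ d rfl
    rw [← hG, this, map_zero]
  intro n
  induction n using Nat.strong_induction_on with
  | _ n ih =>
    intro d hd
    have h1 := h (d 0) (d 1)
    rw [← hG, binomEval_aeval_sub_one, sum_eq_single d] at h1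
    · simpa using h1
    · intro e _ hed
      by_cases h0 : d 0 < e 0
      · simp [Nat.choose_eq_zero_of_lt h0]
      by_cases h1 : d 1 < e 1
      · simp [Nat.choose_eq_zero_of_lt h1]
      have hne : ¬ (e 0 = d 0 ∧ e 1 = d 1) := fun h' => hed <| by
        ext i; fin_cases i
        exacts [h'.1, h'.2]
      rw [ih (e 0 + e 1) (by omega) e rfl, zero_mul]
    · intro hd'
      rw [notMem_support_iff.1 hd', zero_mul]

lemma binomEval_QprimePoly {Q : ℕ → ℕ → ℕ} {c : ℕ × ℕ → ℤ} (hc : IsQdatumFun Q c) (t u : ℕ) :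
    binomEval t u (QprimePoly c) = Q t u := by
  have hs : ∀ {A : Type} [AddCommMonoid A] (f : ℕ × ℕ → A), (∀ p, c p = 0 → f p = 0) →
      ∑ᶠ p, f p = ∑ p ∈ hc.1.toFinset, f p := fun f hf =>
    finsum_eq_sum_of_support_subset _ fun p hp => by
      simpa using fun h => hp (hf p h)
  rw [hc.2, QprimePoly, hs _ fun p hp => by simp [hp], hs _ fun p hp => by simp [hp], map_sum]
  refine sum_congr rfl fun p _ => ?_
  rw [mul_assoc, ← smul_eq_C_mul, map_smul, binomEval_sub_one_pow_mul, smul_eq_mul, mul_assoc]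

/-- The coefficients of `F` alternate in sign, with those of total degree `k` nonnegative. -/
def IsAlternating (k : ℕ) (F : MvPolynomial (Fin 2) ℤ) : Prop :=
  ∀ d : Fin 2 →₀ ℕ, 0 ≤ (-1 : ℤ) ^ (k + d 0 + d 1) * F.coeff d

lemma IsAlternating.add {k : ℕ} {F G : MvPolynomial (Fin 2) ℤ} (hF : IsAlternating k F)
    (hG : IsAlternating k G) : IsAlternating k (F + G) := fun d => by
  rw [coeff_add, mul_add]
  exact add_nonneg (hF d) (hG d)

lemma IsAlternating.neg {k : ℕ} {F : MvPolynomial (Fin 2) ℤ} (hF : IsAlternating k F) :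
    IsAlternating (k + 1) (-F) := fun d => by
  convert hF d using 1
  rw [coeff_neg]
  ring

lemma IsAlternating.X_mul {k : ℕ} {F : MvPolynomial (Fin 2) ℤ} (hF : IsAlternating k F)
    (i : Fin 2) : IsAlternating (k + 1) (X i * F) := fun d => by
  rw [coeff_X_mul']
  split_ifs with h
  · rw [Finsupp.mem_support_iff] at h
    convert hF (d - Finsupp.single i 1) using 2
    set d' : Fin 2 →₀ ℕ := d - Finsupp.single i 1 with hd'
    have hdeg : k + 1 + d 0 + d 1 =
        (k + d' 0 + d' 1) + 2 := by
      fin_cases i <;> simp [hd'] at h ⊢ <;> omega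
    rw [hdeg, pow_add]
    norm_num
  · simp

lemma isAlternating_one : IsAlternating 0 1 := fun d => by
  rw [coeff_one]
  split_ifs with h
  · simp [← h]
  · simp

lemma coeff_aeval_neg (F : MvPolynomial (Fin 2) ℤ) (d : Fin 2 →₀ ℕ) :
    coeff d (aeval (fun i => (-X i : MvPolynomial (Fin 2) ℤ)) F) =
      (-1) ^ (d 0 + d 1) * F.coeff d := by
  induction F using MvPolynomial.induction_on' with
  | monomial e a =>
    have h : aeval (fun i => (-X i : MvPolynomial (Fin 2) ℤ)) (monomial e a) =
        C ((-1) ^ (e 0 + e 1)) * monomial e a := by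
      rw [aeval_monomial, monomial_eq, Finsupp.prod_fintype _ _ (by simp),
        Finsupp.prod_fintype _ _ (by simp), Fin.prod_univ_two, Fin.prod_univ_two,
        neg_pow (X 0 : MvPolynomial (Fin 2) ℤ),
        neg_pow (X 1 : MvPolynomial (Fin 2) ℤ), algebraMap_eq]
      simp only [map_pow, map_neg, map_one]
      ring
    rw [h, coeff_C_mul, coeff_monomial]
    split_ifs with hed
    · rw [hed]
    · simp
  | add p q hp hq => simp only [map_add, coeff_add, hp, hq, mul_add]

end BinomialFunctional

/-- Lattice point counts are given by an alternating polynomial, by deletion-contraction. -/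
lemma PolyMatroid.exists_isAlternating {E : Finset α} (hE : E.Nonempty) :
    ∀ M : PolyMatroid α, (∀ i, M.rk {i} ≤ 1) → ∃ F, IsAlternating (E.card - 1) F ∧
      ∀ t u, (#(M.latticePoints E t u) : ℤ) = binomEval t u F := by
  induction hE using Finset.Nonempty.cons_induction with
  | singleton e =>
    refine fun M _ => ⟨1, by simpa using isAlternating_one, fun t u => ?_⟩
    rw [M.card_latticePoints_singleton, ← pow_zero (MvPolynomial.X 1 - 1 : MvPolynomial (Fin 2) ℤ),
      binomEval_X_one_sub_one_pow]
    simp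
  | cons e E he hE ih =>
    intro M hM
    obtain ⟨F, hF, hFN⟩ := ih M hM
    obtain ⟨G, hG, hGN⟩ := ih (M.contractElem e) (M.contractElem_rk_singleton_le hM e)
    have hadd := (hF.X_mul 0).add (hG.X_mul 1)
    have hcard : (cons e E he).card - 1 = E.card - 1 + 1 := by
      have := hE.card_pos
      rw [card_cons]; omega
    rw [hcard, cons_eq_insert]
    have hrec : ∀ t u, _ := M.card_latticePoints_insert hM hE he
    zify [hFN, hGN] at hrec
    simp only [← binomEval_X_zero_mul, ← binomEval_X_one_mul, ← map_add] at hrec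
    by_cases h : M.rk (insert e E) = M.rk E + M.rk {e}
    · refine ⟨_, hadd.add hF.neg, fun t u => ?_⟩
      rw [map_add, ← hrec, if_pos (by exact_mod_cast h), map_neg]
      ring
    · refine ⟨_, hadd, fun t u => ?_⟩
      rw [← hrec, if_neg (by exact_mod_cast h), add_zero]

lemma stdSimplexSet_eq : stdSimplexSet α = stdSimplex ℝ α := by
  rw [← convexHull_rangle_single_eq_stdSimplex, stdSimplexSet]
  congr 1
  ext x
  simp [eq_comm]

lemma matroidPolytope_subset (M : PolyMatroid α) (hM : ∀ i, M.rk {i} ≤ 1) :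
    matroidPolytope M ⊆ M.polytope := by
  refine convexHull_min ?_ ?_
  · rintro _ ⟨B, hB, rfl⟩
    have hsum (S : Finset α) : ∑ i ∈ S, indicatorVec B i = ((B ∩ S).card : ℝ) := by
      simp [indicatorVec, inter_comm]
    refine ⟨?_, fun S => ?_⟩
    · rw [hsum, inter_univ, ← hB.2, hB.1]
    · rw [hsum]
      exact_mod_cast M.card_inter_le_rk hM hB S
  · rintro x ⟨hx, hxS⟩ y ⟨hy, hyS⟩ a b ha hb hab
    have hsum (S : Finset α) : ∑ i ∈ S, (a • x + b • y) i = a * ∑ i ∈ S, x i + b * ∑ i ∈ S, y i := by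
      simp [sum_add_distrib, mul_sum]
    refine ⟨?_, fun S => ?_⟩
    · rw [hsum, hx, hy, ← add_mul, hab, one_mul]
    · rw [hsum]
      calc _ ≤ a * (M.rk S : ℝ) + b * M.rk S := by gcongr <;> simp_all
        _ = _ := by rw [← add_mul, hab, one_mul]

/-- A nonnegative vector with coordinate sum `u` lies in `uΔ`. -/
lemma mem_smul_stdSimplexSet {u : ℕ} {x : α → ℝ} (hx : ∀ i, 0 ≤ x i) (hs : ∑ i, x i = u)
    [Nonempty α] : x ∈ (u : ℝ) • stdSimplexSet α := by
  rw [stdSimplexSet_eq, Set.mem_smul_set]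
  rcases Nat.eq_zero_or_pos u with rfl | hu
  · have hx0 : x = 0 := by
      rw [Nat.cast_zero, sum_eq_zero_iff_of_nonneg fun i _ => hx i] at hs
      ext i
      exact hs i (mem_univ i)
    exact ⟨Pi.single (Classical.arbitrary α) 1, single_mem_stdSimplex ℝ _, by simp [hx0]⟩
  · have hu' : (0 : ℝ) < u := by exact_mod_cast hu
    refine ⟨(u : ℝ)⁻¹ • x, ⟨fun i => ?_, ?_⟩, smul_inv_smul₀ hu'.ne' x⟩
    · exact mul_nonneg (inv_nonneg.2 hu'.le) (hx i)
    · simp only [Pi.smul_apply, smul_eq_mul, ← mul_sum, hs]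
      exact inv_mul_cancel₀ hu'.ne'

lemma latticePoint_of_mem [Nonempty α] (M : PolyMatroid α) (hM : ∀ i, M.rk {i} ≤ 1) {t u : ℕ}
    {q : α → ℤ} (hq : (fun i => (q i : ℝ)) ∈
      matroidPolytope M + (u : ℝ) • stdSimplexSet α + (t : ℝ) • (-stdSimplexSet α)) :
    M.LatticePoint univ t u q := by
  rw [stdSimplexSet_eq] at hq
  obtain ⟨_, ⟨b, hb, _, ⟨p, hp, rfl⟩, rfl⟩, _, ⟨m, hm, rfl⟩, hsum⟩ := hq
  rw [Set.mem_neg] at hm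
  have hb := matroidPolytope_subset M hM hb
  have hq (S : Finset α) : (∑ i ∈ S, q i : ℝ) =
      ∑ i ∈ S, b i + u * ∑ i ∈ S, p i - t * ∑ i ∈ S, (-m) i := by
    rw [mul_sum, mul_sum, ← sum_add_distrib, ← sum_sub_distrib]
    refine sum_congr rfl fun i _ => ?_
    rw [← congrFun hsum i]
    simp
  refine ⟨by simp, ?_, fun S _ _ => ?_⟩
  · have h := hq univ
    rw [hb.1, hp.2, hm.2, mul_one, mul_one] at h
    exact_mod_cast h
  · have h := hq S
    have h1 : 0 ≤ ∑ i ∈ S, (-m) i := sum_nonneg fun i _ => hm.1 i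
    have h2 : ∑ i ∈ S, p i ≤ 1 := by
      rw [← hp.2]
      exact sum_le_univ_sum_of_nonneg hp.1
    have h3 : (∑ i ∈ S, q i : ℝ) ≤ M.rk S + u := by
      rw [h]
      have := hb.2 S
      have : (u : ℝ) * ∑ i ∈ S, p i ≤ u := mul_le_of_le_one_right (by positivity) h2
      have : 0 ≤ (t : ℝ) * ∑ i ∈ S, (-m) i := by positivity
      linarith
    exact_mod_cast h3

lemma mem_of_latticePoint [Nonempty α] (M : PolyMatroid α) (hM : ∀ i, M.rk {i} ≤ 1) {t u : ℕ}
    {q : α → ℤ} (hq : M.LatticePoint univ t u q) :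
    (fun i => (q i : ℝ)) ∈
      matroidPolytope M + (u : ℝ) • stdSimplexSet α + (t : ℝ) • (-stdSimplexSet α) := by
  obtain ⟨-, hE, hS⟩ := hq
  set A : Finset α := {i | 1 ≤ q i} with hA
  obtain ⟨B, hB, hBA⟩ := M.exists_isBasis_card_inter hM A
  set β : α → ℤ := fun i => if i ∈ B then 1 else 0 with hβ
  set p : α → ℤ := fun i => max (q i - β i) 0 with hp
  have hβA (S : Finset α) : ∑ i ∈ S, β i = ((B ∩ S).card : ℤ) := by
    simp [hβ, inter_comm]
  have hpA : ∑ i, p i ≤ u := by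
    have h1 : ∑ i, p i = ∑ i ∈ A, (q i - β i) := by
      rw [hA, sum_filter]
      refine sum_congr rfl fun i _ => ?_
      simp only [hp, hβ]
      split_ifs <;> omega
    rw [h1, sum_sub_distrib, hβA]
    rcases A.eq_empty_or_nonempty with h | h
    · simp [h]
    · have := hS A (subset_univ _) h
      omega
  obtain ⟨i₀⟩ := ‹Nonempty α›
  set w : α → ℤ := Pi.single i₀ (u - ∑ i, p i) with hw
  have hwsum : ∑ i, w i = u - ∑ i, p i := by simp [hw]
  have hw0 : ∀ i, 0 ≤ w i := by
    have : 0 ≤ w := Pi.single_nonneg.2 (by omega)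
    exact this
  have : Nonempty α := ⟨i₀⟩
  rw [Set.smul_set_neg]
  refine ⟨_, ⟨indicatorVec B, subset_convexHull ℝ _ ⟨B, hB, rfl⟩, fun i => ((p i + w i : ℤ) : ℝ),
    mem_smul_stdSimplexSet (fun i => ?_) ?_, rfl⟩, -(fun i => ((p i + w i - (q i - β i) : ℤ) : ℝ)),
    Set.neg_mem_neg.2 (mem_smul_stdSimplexSet (fun i => ?_) ?_), ?_⟩
  · have : 0 ≤ p i := le_max_right _ _
    exact_mod_cast add_nonneg this (hw0 i)
  · rw [← Int.cast_sum, sum_add_distrib, hwsum]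
    simp
  · have := hw0 i
    have : q i - β i ≤ p i := le_max_left _ _
    exact_mod_cast (by omega : 0 ≤ p i + w i - (q i - β i))
  · have hβE : ∑ i, β i = M.rk univ := by rw [hβA, inter_univ, ← hB.1, hB.2]
    rw [← Int.cast_sum, sum_sub_distrib, sum_add_distrib, sum_sub_distrib, hwsum, hE, hβE]
    push_cast
    ring
  · ext i
    have : indicatorVec B i = (β i : ℝ) := by simp [indicatorVec, hβ]
    simp only [Pi.add_apply, Pi.neg_apply, this]
    push_cast
    ring

lemma Qcount_matroidPolytope [Nonempty α] (M : PolyMatroid α) (hM : ∀ i, M.rk {i} ≤ 1)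
    (t u : ℕ) : Qcount (matroidPolytope M) t u = #(M.latticePoints univ t u) := by
  rw [Qcount, latticeCount, ← Set.ncard_coe_finset]
  congr 1
  ext q
  rw [mem_coe, PolyMatroid.mem_latticePoints]
  exact ⟨latticePoint_of_mem M hM, mem_of_latticePoint M hM⟩

/-- The coefficients of `Q'_M` alternate in sign: writing
`Q'_M = Σ q_{a,b} x^a y^b` with `n = |E|`, the integer `(−1)^{n−1−a−b} q_{a,b}` is
nonnegative for all `a, b`; equivalently every coefficient of
`(−1)^{n−1} Q'_M(−x,−y)` is nonnegative. -/
theorem stmt_6 {α : Type*} [Fintype α] [DecidableEq α] [Nonempty α]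
    (M : PolyMatroid α) (hmat : ∀ i : α, M.rk {i} ≤ 1)
    (c : ℕ × ℕ → ℤ) (hc : IsQdatum (matroidPolytope M) c) :
    (∀ a b : ℕ,
      0 ≤ (-1 : ℤ) ^ (Fintype.card α - 1 + a + b) *
        MvPolynomial.coeff (Finsupp.single 0 a + Finsupp.single 1 b) (QprimePoly c)) ∧
    (∀ d : Fin 2 →₀ ℕ,
      0 ≤ MvPolynomial.coeff d
        ((-1 : MvPolynomial (Fin 2) ℤ) ^ (Fintype.card α - 1) *
          MvPolynomial.aeval (fun i : Fin 2 => -(MvPolynomial.X i : MvPolynomial (Fin 2) ℤ))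
            (QprimePoly c))) := by
  obtain ⟨F, hF, hFN⟩ := PolyMatroid.exists_isAlternating univ_nonempty M hmat
  have hcF : QprimePoly c = F := sub_eq_zero.1 <| eq_zero_of_binomEval_eq_zero fun t u => by
    rw [map_sub, binomEval_QprimePoly hc, Qcount_matroidPolytope M hmat, hFN, sub_self]
  rw [hcF]
  refine ⟨fun a b => ?_, fun d => ?_⟩
  · have h := hF (Finsupp.single 0 a + Finsupp.single 1 b)
    rw [Finsupp.add_apply, Finsupp.add_apply] at h
    simpa using h
  have hC : (-1 : MvPolynomial (Fin 2) ℤ) ^ (Fintype.card α - 1) =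
      MvPolynomial.C ((-1) ^ (Fintype.card α - 1)) := by simp
  rw [hC, MvPolynomial.coeff_C_mul, coeff_aeval_neg, ← mul_assoc, ← pow_add, ← add_assoc]
  exact hF d

end
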